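/- Let K be a field of characteristic 0, σ ⊆ N_ℚ a pointed full-dimensional rational polyhedral cone, A = K[σ^∨ ∩ M], and θ ⊆ M_ℚ the maximal linear subspace contained in σ^∨. Then the Makar-Limanov invariant ML(A), defined as the intersection of the kernels of all locally nilpotent derivations on A, equals the semigroup algebra K[θ ∩ M]. In particular, ML(A) = K if and only if σ is full-dimensional in N_ℚ. -/

import Mathlib

open scoped BigOperators Pointwise

noncomputable section

/-- Rational `n`-space `N_ℚ ≅ M_ℚ ≅ ℚⁿ`. -/
abbrev Vec (n : ℕ) := Fin n → ℚ

/-- The natural pairing `M_ℚ × N_ℚ → ℚ`. -/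
def pairQ {n : ℕ} (m p : Vec n) : ℚ := ∑ i, m i * p i

/-- The dual cone of a subset of `N_ℚ`. -/
def dualCone {n : ℕ} (σ : Set (Vec n)) : Set (Vec n) :=
  {m | ∀ p ∈ σ, 0 ≤ pairQ m p}

/-- Inclusion of the lattice `M = ℤⁿ` into `M_ℚ`. -/
def toQ {n : ℕ} (v : Fin n → ℤ) : Vec n := fun i => (v i : ℚ)

/-- A vector of `ℚⁿ` is a lattice vector if all its coordinates are integers. -/
def IsLatticeVec {n : ℕ} (v : Vec n) : Prop := ∀ i, ∃ z : ℤ, v i = (z : ℚ)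

/-- The convex cone generated by a set: all finite nonnegative rational combinations. -/
def coneHull {n : ℕ} (S : Set (Vec n)) : Set (Vec n) :=
  {x | ∃ (G : Finset (Vec n)) (c : Vec n → ℚ), ↑G ⊆ S ∧ (∀ g, 0 ≤ c g) ∧
    x = ∑ g ∈ G, c g • g}

/-- A rational polyhedral cone: the cone generated by finitely many lattice vectors. -/
def IsRatPolyCone {n : ℕ} (σ : Set (Vec n)) : Prop :=
  ∃ G : Finset (Vec n), (∀ g ∈ G, IsLatticeVec g) ∧ σ = coneHull ↑G

/-- A cone is pointed if it contains no line through the origin. -/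
def PointedCone' {n : ℕ} (σ : Set (Vec n)) : Prop := σ ∩ (-σ) ⊆ {0}

/-- A cone is of full dimension if it spans the ambient space. -/
def FullDim {n : ℕ} (σ : Set (Vec n)) : Prop := Submodule.span ℚ σ = ⊤

/-- `ρ` is the extremal ray of `σ` generated by the primitive lattice vector `ν`. -/
def IsExtremalRay {n : ℕ} (σ ρ : Set (Vec n)) (ν : Vec n) : Prop :=
  IsLatticeVec ν ∧ ν ≠ 0 ∧ (∀ c : ℚ, 0 < c → IsLatticeVec (c • ν) → 1 ≤ c) ∧
  ρ = {x | ∃ c : ℚ, 0 ≤ c ∧ x = c • ν} ∧ ρ ⊆ σ ∧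
  (∀ x ∈ σ, ∀ y ∈ σ, x + y ∈ ρ → x ∈ ρ)

/-- The submonoid `σ^∨ ∩ M` of lattice points of the dual cone. -/
def latticeCone {n : ℕ} (σ : Set (Vec n)) : AddSubmonoid (Fin n → ℤ) where
  carrier := {m | toQ m ∈ dualCone σ}
  zero_mem' := by
    intro p hp
    simp [pairQ, toQ]
  add_mem' := by
    intro a b ha hb p hp
    have h : pairQ (toQ (a + b)) p = pairQ (toQ a) p + pairQ (toQ b) p := by
      simp [pairQ, toQ, add_mul, Finset.sum_add_distrib]
    rw [h]
    exact add_nonneg (ha p hp) (hb p hp)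

/-- A derivation is locally nilpotent if every element is annihilated by some iterate. -/
def IsLND {R A : Type*} [CommRing R] [CommRing A] [Algebra R A]
    (D : Derivation R A A) : Prop :=
  ∀ a : A, ∃ k : ℕ, (⇑D)^[k] a = 0


/-- **Farkas' lemma** for finitely many linear functionals over an ordered field. -/
theorem farkas_of_forall_nonneg {k V ι : Type*} [Field k] [LinearOrder k] [IsStrictOrderedRing k]
    [AddCommGroup V] [Module k V] (s : Finset ι) (a : ι → Module.Dual k V) (b : Module.Dual k V)
    (h : ∀ x, (∀ i ∈ s, 0 ≤ a i x) → 0 ≤ b x) :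
    ∃ c : ι → k, (∀ i, 0 ≤ c i) ∧ b = ∑ i ∈ s, c i • a i := by
  classical
  induction s using Finset.induction_on generalizing a b with
  | empty =>
    refine ⟨0, fun _ => le_rfl, ?_⟩
    ext x
    have h1 := h x (by simp)
    have h2 := h (-x) (by simp)
    simp only [map_neg] at h2
    simpa using le_antisymm (by linarith) h1
  | insert j s hj ih =>
    by_cases hb : ∀ x, (∀ i ∈ s, 0 ≤ a i x) → 0 ≤ b x
    · obtain ⟨c, hc, hbc⟩ := ih a b hb
      refine ⟨Function.update c j 0, fun i => ?_, ?_⟩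
      · by_cases hi : i = j <;> simp [hi, hc]
      · rw [Finset.sum_insert hj, hbc]
        simp only [Function.update_self, zero_smul, zero_add]
        refine Finset.sum_congr rfl fun i hi => ?_
        rw [Function.update_of_ne (ne_of_mem_of_not_mem hi hj)]
    · push Not at hb
      obtain ⟨y, hy, hby⟩ := hb
      have hjy : a j y < 0 := by
        by_contra! hjy
        exact absurd (h y (by simpa [hjy] using hy)) (not_le.2 hby)
      set x₀ := (-(a j y)⁻¹) • y with hx₀
      have hpos : 0 < -(a j y)⁻¹ := by simpa using hjy
      have hj₀ : a j x₀ = -1 := by simp [hx₀, hjy.ne]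
      have hs₀ : ∀ i ∈ s, 0 ≤ a i x₀ := fun i hi => by
        rw [hx₀, map_smul, smul_eq_mul]; exact mul_nonneg hpos.le (hy i hi)
      have hb₀ : b x₀ < 0 := by
        rw [hx₀, map_smul, smul_eq_mul]; exact mul_neg_of_pos_of_neg hpos hby
      obtain ⟨c, hc, hbc⟩ := ih (fun i => a i + a i x₀ • a j) (b + b x₀ • a j) (by
        intro x hx
        have := h (x + a j x • x₀) (by
          intro i hi
          rcases Finset.mem_insert.1 hi with rfl | hi
          · simp [hj₀]
          · have := hx i hi
            simp only [LinearMap.add_apply, LinearMap.smul_apply, smul_eq_mul] at this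
            simp only [map_add, map_smul, smul_eq_mul]
            linarith)
        simp only [map_add, map_smul, smul_eq_mul] at this
        simp only [LinearMap.add_apply, LinearMap.smul_apply, smul_eq_mul]
        linarith)
      have hsum : 0 ≤ ∑ i ∈ s, c i * a i x₀ :=
        Finset.sum_nonneg fun i hi => mul_nonneg (hc i) (hs₀ i hi)
      refine ⟨Function.update c j (∑ i ∈ s, c i * a i x₀ - b x₀), fun i => ?_, ?_⟩
      · by_cases hi : i = j
        · subst hi; simp only [Function.update_self]; linarith
        · simp [hi, hc]
      · rw [Finset.sum_insert hj, Function.update_self]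
        have : ∑ i ∈ s, Function.update c j (∑ i ∈ s, c i * a i x₀ - b x₀) i • a i
            = ∑ i ∈ s, c i • a i := Finset.sum_congr rfl fun i hi => by
          rw [Function.update_of_ne (ne_of_mem_of_not_mem hi hj)]
        rw [this]
        simp only [smul_add, Finset.sum_add_distrib, smul_smul] at hbc
        rw [← Finset.sum_smul] at hbc
        exact (eq_sub_of_add_eq hbc).trans (by module)

section Pairing

variable {n : ℕ}

theorem pairQ_eq_dotProduct (m p : Vec n) : pairQ m p = m ⬝ᵥ p := rfl

theorem pairQ_add_left (m m' p : Vec n) : pairQ (m + m') p = pairQ m p + pairQ m' p :=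
  add_dotProduct m m' p

theorem pairQ_smul_left (c : ℚ) (m p : Vec n) : pairQ (c • m) p = c * pairQ m p :=
  smul_dotProduct c m p

theorem pairQ_neg_left (m p : Vec n) : pairQ (-m) p = -pairQ m p :=
  neg_dotProduct m p

theorem pairQ_neg_right (m p : Vec n) : pairQ m (-p) = -pairQ m p :=
  dotProduct_neg m p

theorem pairQ_sum_left {ι : Type*} (s : Finset ι) (m : ι → Vec n) (p : Vec n) :
    pairQ (∑ i ∈ s, m i) p = ∑ i ∈ s, pairQ (m i) p :=
  sum_dotProduct s m p

theorem pairQ_sum_right {ι : Type*} (s : Finset ι) (m : Vec n) (p : ι → Vec n) :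
    pairQ m (∑ i ∈ s, p i) = ∑ i ∈ s, pairQ m (p i) :=
  dotProduct_sum m s p

theorem toQ_add (u v : Fin n → ℤ) : toQ (u + v) = toQ u + toQ v := by
  ext i; simp [toQ]

theorem toQ_nsmul (k : ℕ) (v : Fin n → ℤ) : toQ (k • v) = (k : ℚ) • toQ v := by
  ext i; simp [toQ]

theorem exists_toQ_eq_smul (v : Vec n) : ∃ N : ℕ, 0 < N ∧ ∃ z : Fin n → ℤ, toQ z = (N : ℚ) • v := by
  refine ⟨∏ i, (v i).den, Finset.prod_pos fun i _ => (v i).den_pos,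
    fun i => (∏ j ∈ Finset.univ.erase i, ((v j).den : ℤ)) * (v i).num, ?_⟩
  ext i
  rw [← Finset.mul_prod_erase _ _ (Finset.mem_univ i)]
  simp only [toQ, Pi.smul_apply, smul_eq_mul]
  push_cast
  conv_rhs => rw [mul_right_comm, mul_comm _ (v i), Rat.mul_den_eq_num, mul_comm]

theorem mem_dualCone_coneHull {G : Finset (Vec n)} {m : Vec n} :
    m ∈ dualCone (coneHull (G : Set (Vec n))) ↔ ∀ g ∈ G, 0 ≤ pairQ m g := by
  constructor
  · intro h g hg
    exact h g ⟨{g}, 1, by simpa using hg, by simp, by simp⟩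
  · rintro h p ⟨H, c, hH, hc, rfl⟩
    rw [pairQ_sum_right]
    refine Finset.sum_nonneg fun g hg => ?_
    rw [pairQ_eq_dotProduct, dotProduct_smul]
    exact mul_nonneg (hc g) (h g (hH hg))

theorem mem_coneHull_of_forall_dualCone {G : Finset (Vec n)} {p : Vec n}
    (h : ∀ m ∈ dualCone (coneHull (G : Set (Vec n))), 0 ≤ pairQ m p) :
    p ∈ coneHull (G : Set (Vec n)) := by
  obtain ⟨c, hc, hp⟩ := farkas_of_forall_nonneg G (fun g => dotProductEquiv ℚ (Fin n) g)
    (dotProductEquiv ℚ (Fin n) p) (by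
      intro x hx
      simp only [dotProductEquiv_apply_apply, dotProduct_comm _ x] at hx ⊢
      exact h x (mem_dualCone_coneHull.2 hx))
  refine ⟨G, c, subset_rfl, hc, (dotProductEquiv ℚ (Fin n)).injective ?_⟩
  simpa using hp

theorem eq_zero_of_forall_pairQ_eq_zero {σ : Set (Vec n)} (hfull : FullDim σ) {m : Vec n}
    (h : ∀ p ∈ σ, pairQ m p = 0) : m = 0 := by
  have hle : Submodule.span ℚ σ ≤ LinearMap.ker (dotProductEquiv ℚ (Fin n) m) :=
    Submodule.span_le.2 fun p hp => h p hp
  rw [hfull, top_le_iff, LinearMap.ker_eq_top] at hle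
  simpa using hle

/-- The dual of a pointed cone contains a vector that is positive on all nonzero generators. -/
theorem exists_forall_pairQ_pos {G : Finset (Vec n)}
    (hpt : PointedCone' (coneHull (G : Set (Vec n)))) :
    ∃ w ∈ dualCone (coneHull (G : Set (Vec n))), ∀ g ∈ G, g ≠ 0 → 0 < pairQ w g := by
  have hex : ∀ g : Vec n, ∃ w ∈ dualCone (coneHull (G : Set (Vec n))),
      g ∈ G → g ≠ 0 → 0 < pairQ w g := by
    intro g
    by_contra! hg
    obtain ⟨hgG, hg0, -⟩ := hg 0 (fun p _ => by simp [pairQ])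
    refine hg0 (hpt ⟨⟨{g}, 1, by simpa using hgG, by simp, by simp⟩, ?_⟩)
    refine mem_coneHull_of_forall_dualCone fun m hm => ?_
    rw [pairQ_neg_right]
    linarith [(hg m hm).2.2]
  choose w hw hpos using hex
  refine ⟨∑ g ∈ G, w g, fun p hp => ?_, fun g hg hg0 => ?_⟩
  · rw [pairQ_sum_left]
    exact Finset.sum_nonneg fun g _ => hw g p hp
  · rw [pairQ_sum_left]
    refine Finset.sum_pos' (fun h _ => mem_dualCone_coneHull.1 (hw h) g hg) ⟨g, hg, hpos g hg hg0⟩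

/-- An irredundant system among the inequalities defining the dual cone. -/
theorem exists_irredundant (G : Finset (Vec n)) :
    ∃ H ⊆ G, (∀ m : Vec n, (∀ g ∈ H, 0 ≤ pairQ m g) → ∀ g ∈ G, 0 ≤ pairQ m g) ∧
      ∀ g ∈ H, ∃ m : Vec n, pairQ m g < 0 ∧ ∀ h ∈ H, h ≠ g → 0 ≤ pairQ m h := by
  classical
  obtain ⟨H, hH, hmin⟩ := WellFounded.has_min (wellFounded_lt (α := Finset (Vec n)))
    {H | H ⊆ G ∧ ∀ m : Vec n, (∀ g ∈ H, 0 ≤ pairQ m g) → ∀ g ∈ G, 0 ≤ pairQ m g}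
    ⟨G, subset_rfl, fun _ => id⟩
  refine ⟨H, hH.1, hH.2, fun g hg => ?_⟩
  by_contra! hcon
  refine hmin (H.erase g) ⟨(Finset.erase_subset g H).trans hH.1, fun m hm => hH.2 m ?_⟩
    (Finset.erase_ssubset hg)
  have hne : ∀ h ∈ H, h ≠ g → 0 ≤ pairQ m h := fun h hh e => hm h (Finset.mem_erase.2 ⟨e, hh⟩)
  intro h hh
  by_cases e : h = g
  · subst e
    by_contra! hlt
    obtain ⟨h', h1, h2, h3⟩ := hcon m hlt
    exact absurd (hne h' h1 h2) (not_le.2 h3)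
  · exact hne h hh e

/-- The functional on the lattice defined by an integral vector. -/
theorem exists_addMonoidHom_pairQ {g : Vec n} (hg : IsLatticeVec g) :
    ∃ f : (Fin n → ℤ) →+ ℤ, ∀ x, (f x : ℚ) = pairQ (toQ x) g := by
  choose z hz using hg
  refine ⟨⟨⟨fun x => ∑ i, x i * z i, by simp⟩, fun x y => by
    simp [add_mul, Finset.sum_add_distrib]⟩, fun x => ?_⟩
  simp [pairQ, toQ, hz]

/-- For every nonzero lattice point `m` of the dual cone there is a Demazure root `e` (up to the
normalisation of `f`) whose associated derivation does not kill `χ^m`. -/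
theorem exists_demazure_root {σ : Set (Vec n)} (hσ : IsRatPolyCone σ) (hpt : PointedCone' σ)
    (hfull : FullDim σ) {m : Fin n → ℤ} (hm : m ∈ latticeCone σ) (hm0 : m ≠ 0) :
    ∃ (f : (Fin n → ℤ) →+ ℤ) (e : Fin n → ℤ), (∀ x ∈ latticeCone σ, 0 ≤ f x) ∧ f e < 0 ∧
      (∀ x ∈ latticeCone σ, f x ≠ 0 → x + e ∈ latticeCone σ) ∧ f m ≠ 0 := by
  obtain ⟨G, hG, rfl⟩ := hσ
  obtain ⟨H, hHG, hH, hirr⟩ := exists_irredundant G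
  have hmem : ∀ {x : Fin n → ℤ}, x ∈ latticeCone (coneHull (G : Set (Vec n))) ↔
      ∀ g ∈ H, 0 ≤ pairQ (toQ x) g := fun {x} =>
    ⟨fun hx g hg => mem_dualCone_coneHull.1 hx g (hHG hg),
      fun hx => mem_dualCone_coneHull.2 (hH _ hx)⟩
  have hne : ∀ g ∈ H, g ≠ 0 := by
    rintro g hg rfl
    obtain ⟨x, hx, -⟩ := hirr 0 hg
    simp [pairQ] at hx
  obtain ⟨g, hg, hmg⟩ : ∃ g ∈ H, pairQ (toQ m) g ≠ 0 := by
    by_contra! hcon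
    refine hm0 ?_
    have hneg : -toQ m ∈ dualCone (coneHull (G : Set (Vec n))) :=
      mem_dualCone_coneHull.2 (hH _ fun g hg => by simp [pairQ_neg_left, hcon g hg])
    have hzero : toQ m = 0 := eq_zero_of_forall_pairQ_eq_zero hfull fun p hp => by
      have h1 := hm p hp
      have h2 := hneg p hp
      rw [pairQ_neg_left] at h2
      linarith
    ext i
    simpa [toQ] using congrFun hzero i
  obtain ⟨f, hf⟩ := exists_addMonoidHom_pairQ (hG g (hHG hg))
  have hfnn : ∀ x ∈ latticeCone (coneHull (G : Set (Vec n))), 0 ≤ f x := fun x hx => by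
    have := hmem.1 hx g hg
    rw [← hf] at this
    exact_mod_cast this
  have hfm : f m ≠ 0 := fun h => hmg (by rw [← hf, h, Int.cast_zero])
  have hval : ∃ d : ℕ, 0 < d ∧ ∃ x, f x = d :=
    ⟨(f m).natAbs, Int.natAbs_pos.2 hfm, m, (Int.natAbs_of_nonneg (hfnn m hm)).symm⟩
  classical
  obtain ⟨hd, x₀, hx₀⟩ := Nat.find_spec hval
  have hdmin := fun k => Nat.find_min' hval (m := k)
  set d := Nat.find hval
  obtain ⟨w, hw, hwpos⟩ := exists_forall_pairQ_pos hpt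
  obtain ⟨y, hyg, hy⟩ := hirr g hg
  obtain ⟨N, hN, u, hu⟩ := exists_toQ_eq_smul (pairQ w g • y + (-pairQ y g) • w)
  have hN' : (0 : ℚ) < N := by exact_mod_cast hN
  have hwg := hwpos g (hHG hg) (hne g hg)
  have hug : pairQ (toQ u) g = 0 := by
    rw [hu]
    simp only [pairQ_smul_left, pairQ_add_left]
    ring
  have huh : ∀ h ∈ H, h ≠ g → 0 < pairQ (toQ u) h := fun h hh hhg => by
    rw [hu]
    simp only [pairQ_smul_left, pairQ_add_left]
    have h1 := mul_nonneg hwg.le (hy h hh hhg)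
    have h2 := mul_pos (neg_pos.2 hyg) (hwpos h (hHG hh) (hne h hh))
    exact mul_pos hN' (by linarith)
  have hlarge : ∀ᶠ k : ℕ in Filter.atTop,
      ∀ h ∈ H, h ≠ g → 0 ≤ pairQ (toQ (-x₀ + k • u)) h := by
    rw [Filter.eventually_all_finset]
    intro h hh
    by_cases hhg : h = g
    · simp [hhg]
    · obtain ⟨k₀, hk₀⟩ := exists_nat_ge (-pairQ (toQ (-x₀)) h / pairQ (toQ u) h)
      filter_upwards [Filter.eventually_ge_atTop k₀] with k hk _
      rw [div_le_iff₀ (huh h hh hhg)] at hk₀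
      rw [toQ_add, toQ_nsmul, pairQ_add_left, pairQ_smul_left]
      have hkk : (k₀ : ℚ) ≤ k := by exact_mod_cast hk
      linarith [mul_le_mul_of_nonneg_right hkk (huh h hh hhg).le]
  obtain ⟨k, hk⟩ := hlarge.exists
  have hfu : f u = 0 := by
    have := hf u
    rw [hug] at this
    exact_mod_cast this
  have hfe : f (-x₀ + k • u) = -d := by
    rw [map_add, map_neg, map_nsmul, hfu, hx₀, smul_zero, add_zero]
  refine ⟨f, -x₀ + k • u, hfnn, by rw [hfe]; omega, fun x hx hfx => ?_, hfm⟩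
  refine hmem.2 fun h hh => ?_
  by_cases hhg : h = g
  · subst hhg
    have h0 := hfnn x hx
    have h1 := hdmin (f x).natAbs ⟨Int.natAbs_pos.2 hfx, x, (Int.natAbs_of_nonneg h0).symm⟩
    rw [← hf, map_add, hfe]
    have : 0 ≤ f x + -d := by omega
    exact_mod_cast this
  · rw [toQ_add, pairQ_add_left]
    exact add_nonneg (hmem.1 hx h hh) (hk h hh hhg)

end Pairing

section HomogeneousDerivation

open AddMonoidAlgebra

variable (K : Type*) [Field K] {M : Type*} [AddCommGroup M] (S : AddSubmonoid M)
  (f : M →+ ℤ) (e : M)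

open Classical in
/-- Translation by `e` on `S`, with value `0` where it leaves `S`. -/
def shift (m : S) : S := if h : (m : M) + e ∈ S then ⟨m + e, h⟩ else 0

/-- The linear map `χ^m ↦ f(m) χ^{m+e}` on the semigroup algebra of `S`. -/
def rootMap : AddMonoidAlgebra K S →ₗ[K] AddMonoidAlgebra K S :=
  Finsupp.linearCombination K (fun m : S => single (shift S e m) (f m : K)) ∘ₗ
    (coeffLinearEquiv K).toLinearMap

variable {S f e}

theorem coe_shift {m : S} (h : (m : M) + e ∈ S) : (shift S e m : M) = m + e := by
  simp [shift, h]

variable {K}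

theorem rootMap_single (m : S) (c : K) :
    rootMap K S f e (single m c) = single (shift S e m) (c * f m) := by
  simp [rootMap]

theorem rootMap_mul (he : ∀ x ∈ S, f x ≠ 0 → x + e ∈ S) (a b : AddMonoidAlgebra K S) :
    rootMap K S f e (a * b) = a • rootMap K S f e b + b • rootMap K S f e a := by
  induction a using induction_linear with
  | zero => simp
  | add a₁ a₂ h₁ h₂ =>
    rw [add_mul, map_add, h₁, h₂, map_add, add_smul, smul_add]
    abel
  | single m c =>
    induction b using induction_linear with
    | zero => simp
    | add b₁ b₂ h₁ h₂ =>
      rw [mul_add, map_add, h₁, h₂, map_add, add_smul, smul_add]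
      abel
    | single m' c' =>
      have key : ∀ (m m' : S) (c c' : K), single (m + shift S e m') (c * (c' * (f m' : K)))
          = single (shift S e (m + m')) (c * (c' * (f m' : K))) := by
        intro m m' c c'
        by_cases h : f m' = 0
        · simp [h]
        · congr 1
          have h' := he m' m'.2 h
          have h'' : ((m + m' : S) : M) + e ∈ S := by
            rw [AddSubmonoid.coe_add, add_assoc]; exact S.add_mem m.2 h'
          ext
          rw [coe_shift h'', AddSubmonoid.coe_add, coe_shift h', AddSubmonoid.coe_add, add_assoc]
      simp only [smul_eq_mul, rootMap_single, single_mul_single, key]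
      rw [add_comm m' m, ← single_add]
      congr 1
      simp only [AddSubmonoid.coe_add, map_add, Int.cast_add]
      ring

/-- The homogeneous derivation `χ^m ↦ f(m) χ^{m+e}` on the semigroup algebra of `S`. -/
def rootDerivation (he : ∀ x ∈ S, f x ≠ 0 → x + e ∈ S) :
    Derivation K (AddMonoidAlgebra K S) (AddMonoidAlgebra K S) :=
  Derivation.mk' (rootMap K S f e) (rootMap_mul he)

theorem rootDerivation_apply (he : ∀ x ∈ S, f x ≠ 0 → x + e ∈ S) (a : AddMonoidAlgebra K S) :
    rootDerivation he a = rootMap K S f e a := rfl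

theorem isLND_rootDerivation (he : ∀ x ∈ S, f x ≠ 0 → x + e ∈ S) (hf : ∀ x ∈ S, 0 ≤ f x)
    (hfe : f e < 0) : IsLND (rootDerivation (K := K) he) := by
  have hpow : ∀ k : ℕ, ∀ a, (⇑(rootDerivation (K := K) he))^[k] a = (rootMap K S f e ^ k) a :=
    fun k a => (Module.End.pow_apply _ k a).symm
  have hsingle : ∀ (k : ℕ) (m : S) (c : K), f m < k → (rootMap K S f e ^ k) (single m c) = 0 := by
    intro k
    induction k with
    | zero => intro m c h; exact absurd (hf m m.2) (by simpa using h)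
    | succ k ih =>
      intro m c h
      rw [pow_succ, Module.End.mul_apply, rootMap_single]
      by_cases h0 : f m = 0
      · simp [h0]
      · refine ih _ _ ?_
        rw [coe_shift (he m m.2 h0), map_add]
        push_cast at h
        omega
  intro a
  simp only [hpow]
  induction a using induction_linear with
  | zero => exact ⟨0, by simp⟩
  | add a b ha hb =>
    obtain ⟨k, hk⟩ := ha
    obtain ⟨l, hl⟩ := hb
    refine ⟨k + l, ?_⟩
    rw [map_add, pow_add, Module.End.mul_apply _ _ b, hl, ← pow_add, add_comm k l, pow_add,
      Module.End.mul_apply, hk]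
    simp
  | single m c => exact ⟨(f m).toNat + 1, hsingle _ m c (by push_cast; omega)⟩

theorem coeff_rootMap_shift (he : ∀ x ∈ S, f x ≠ 0 → x + e ∈ S)
    (a : AddMonoidAlgebra K S) {m : S} (hm : f m ≠ 0) :
    (rootMap K S f e a).coeff (shift S e m) = a.coeff m * f m := by
  classical
  induction a using induction_linear with
  | zero => simp
  | add a b ha hb => simp [ha, hb, add_mul]
  | single m' c =>
    rw [rootMap_single, coeff_single, coeff_single, Finsupp.single_apply, Finsupp.single_apply]
    by_cases h : m' = m
    · simp [h]
    · rw [if_neg h, zero_mul]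
      by_cases h0 : f m' = 0
      · simp [h0]
      · refine if_neg fun hs => h (Subtype.ext ?_)
        have := congrArg (Subtype.val) hs
        rw [coe_shift (he m' m'.2 h0), coe_shift (he m m.2 hm)] at this
        exact add_right_cancel this

end HomogeneousDerivation

open AddMonoidAlgebra in
/-- The Makar-Limanov invariant of the semigroup algebra of the dual of a pointed cone of full
dimension is trivial. -/
theorem makarLimanov_eq_range {n : ℕ} (K : Type*) [Field K] [CharZero K]
    {σ : Set (Vec n)} (hσ : IsRatPolyCone σ) (hpt : PointedCone' σ) (hfull : FullDim σ) :
    {x : AddMonoidAlgebra K ↥(latticeCone σ) |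
        ∀ D : Derivation K (AddMonoidAlgebra K ↥(latticeCone σ))
          (AddMonoidAlgebra K ↥(latticeCone σ)), IsLND D → D x = 0}
      = Set.range (algebraMap K (AddMonoidAlgebra K ↥(latticeCone σ))) := by
  classical
  ext x
  constructor
  · intro hx
    refine ⟨x.coeff 0, ?_⟩
    rw [coe_algebraMap]
    ext m
    simp only [Function.comp_apply, Algebra.algebraMap_self, RingHom.id_apply, coeff_single,
      Finsupp.single_apply]
    by_cases h : 0 = m
    · rw [if_pos h, h]
    · rw [if_neg h]
      obtain ⟨f, e, hf, hfe, he, hfm⟩ := exists_demazure_root hσ hpt hfull m.2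
        fun h0 => h (Subtype.ext h0.symm)
      have hD := hx (rootDerivation he) (isLND_rootDerivation he hf hfe)
      have := coeff_rootMap_shift he x hfm
      rw [← rootDerivation_apply he, hD, coeff_zero, Finsupp.zero_apply, eq_comm,
        mul_eq_zero] at this
      exact (this.resolve_right (by exact_mod_cast hfm)).symm
  · rintro ⟨c, rfl⟩ D -
    exact D.map_algebraMap c

open AddMonoidAlgebra in
/-- Lemma 4.3 (toric-ML): for the affine semigroup algebra `A = K[σ^∨ ∩ M]` of a
pointed full-dimensional rational polyhedral cone `σ`, the Makar-Limanov invariant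
`ML(A) = ∩_{∂ LND} ker ∂` equals the semigroup algebra `K[θ ∩ M]`, where `θ` is the
maximal linear subspace contained in `σ^∨`; in particular `ML(A) = K` iff `σ` is
full-dimensional. -/
theorem stmt19 {n : ℕ} (K : Type*) [Field K] [CharZero K]
    (σ : Set (Vec n))
    (hσ : IsRatPolyCone σ) (hpt : PointedCone' σ) (hfull : FullDim σ) :
    ({x : AddMonoidAlgebra K ↥(latticeCone σ) |
        ∀ D : Derivation K (AddMonoidAlgebra K ↥(latticeCone σ))
          (AddMonoidAlgebra K ↥(latticeCone σ)), IsLND D → D x = 0}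
      = ↑(Submodule.span K
        {y : AddMonoidAlgebra K ↥(latticeCone σ) |
          ∃ m : latticeCone σ, -(toQ m) ∈ dualCone σ ∧ y = single m (1 : K)})) ∧
    ({x : AddMonoidAlgebra K ↥(latticeCone σ) |
        ∀ D : Derivation K (AddMonoidAlgebra K ↥(latticeCone σ))
          (AddMonoidAlgebra K ↥(latticeCone σ)), IsLND D → D x = 0}
      = Set.range (algebraMap K (AddMonoidAlgebra K ↥(latticeCone σ))) ↔
      FullDim σ) := by
  have hML := makarLimanov_eq_range K hσ hpt hfull
  refine ⟨?_, iff_of_true hML hfull⟩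
  have hset : {y : AddMonoidAlgebra K ↥(latticeCone σ) |
      ∃ m : latticeCone σ, -(toQ m) ∈ dualCone σ ∧ y = single m (1 : K)} = {1} := by
    ext y
    constructor
    · rintro ⟨m, hm, rfl⟩
      have hzero : toQ m = 0 := eq_zero_of_forall_pairQ_eq_zero hfull fun p hp => by
        have h1 := m.2 p hp
        have h2 := hm p hp
        rw [pairQ_neg_left] at h2
        linarith
      have : m = 0 := by
        ext i
        simpa [toQ] using congrFun hzero i
      rw [this]
      exact one_def.symm
    · rintro rfl
      exact ⟨0, fun p _ => by simp [pairQ, toQ], one_def⟩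
  rw [hML, hset]
  ext x
  simp only [Set.mem_range, SetLike.mem_coe, Submodule.mem_span_singleton,
    Algebra.algebraMap_eq_smul_one]
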